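/- arXiv:2409.18488 — 6 statements merged into one kernel-verified Lean document; each statement's English description precedes it below -/
import Mathlib

section
/- Let H ∈ F_{q^m}^{(n−k)×n} and suppose that every nonzero row vector c ∈ F_{q^m}^n with H·cᵀ = 0 has sum-rank weight at least d. Let B = diag(B^{(1)},...,B^{(ℓ)}) ∈ F_q^{t×n} be a block-diagonal support basis with rank profile (t_1,...,t_ℓ) and t = t_1+...+t_ℓ ≤ d−1. Then rank_{q^m}(H·Bᵀ) = t, i.e., H·Bᵀ has full column rank over F_{q^m}. -/
open Matrix

/-- A matrix of full row rank has a right inverse. -/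
theorem Matrix.exists_mul_eq_one_of_rank_eq_card {m n F : Type*} [Fintype m] [DecidableEq m]
    [Fintype n] [Field F] {A : Matrix m n F} (hA : A.rank = Fintype.card m) :
    ∃ R : Matrix n m F, A * R = 1 := by
  classical
  refine Matrix.mulVec_surjective_iff_exists_right_inverse.mp ?_
  have htop : LinearMap.range A.mulVecLin = ⊤ :=
    Submodule.eq_top_of_finrank_eq (by simpa [Matrix.rank] using hA)
  exact LinearMap.range_eq_top.mp htop

/-- A matrix with trivial kernel has full column rank. -/
theorem Matrix.rank_eq_card_of_forall_mulVec_eq_zero {m n F : Type*} [Fintype n] [Field F]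
    {A : Matrix m n F} (hA : ∀ x, A *ᵥ x = 0 → x = 0) : A.rank = Fintype.card n := by
  have hinj : Function.Injective A.mulVecLin :=
    (injective_iff_map_eq_zero A.mulVecLin).mpr hA
  rw [Matrix.rank, LinearMap.finrank_range_of_inj hinj, Module.finrank_fintype_fun_eq_card]

/-- Each block of `x` multiplied by the transpose of a block-diagonal matrix over a subfield. -/
theorem Matrix.blockDiagonal'_map_transpose_mulVec_apply {o F K : Type*} {m' n' : o → Type*}
    [Fintype o] [DecidableEq o] [∀ i, Fintype (m' i)] [Field F] [Field K] [Algebra F K]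
    (B : ∀ i, Matrix (m' i) (n' i) F) (x : (Σ i, m' i) → K) (i : o) (j : n' i) :
    (((Matrix.blockDiagonal' B).map (algebraMap F K))ᵀ *ᵥ x) ⟨i, j⟩ =
      ∑ s, B i s j • x ⟨i, s⟩ := by
  rw [Matrix.mulVec, dotProduct, Fintype.sum_sigma, Fintype.sum_eq_single i]
  · simp [Matrix.blockDiagonal'_apply_eq, Algebra.smul_def]
  · intro i' hi'
    simp [Matrix.blockDiagonal'_apply_ne _ _ _ hi']

/-- The span of combinations of finitely many vectors has dimension at most their number. -/
theorem finrank_span_range_sum_smul_le {m n F V : Type*} [Fintype m] [Field F]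
    [AddCommGroup V] [Module F V] (B : Matrix m n F) (x : m → V) :
    Module.finrank F (Submodule.span F (Set.range fun j => ∑ s, B s j • x s)) ≤
      Fintype.card m := by
  have : Module.Finite F (Submodule.span F (Set.range x)) :=
    Module.Finite.span_of_finite F (Set.finite_range x)
  refine (Submodule.finrank_mono (Submodule.span_le.mpr ?_)).trans (finrank_range_le_card x)
  rintro _ ⟨j, rfl⟩
  exact Submodule.sum_mem _ fun s _ =>
    Submodule.smul_mem _ _ (Submodule.subset_span (Set.mem_range_self s))

/-- Combinations by the columns of a matrix of full row rank determine the combined vectors. -/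
theorem eq_zero_of_sum_smul_eq_zero_of_rank_eq_card {m n F V : Type*} [Fintype m] [Fintype n]
    [Field F] [AddCommGroup V] [Module F V] {B : Matrix m n F} (hB : B.rank = Fintype.card m)
    {x : m → V} (hx : ∀ j, ∑ s, B s j • x s = 0) : x = 0 := by
  classical
  obtain ⟨R, hR⟩ := Matrix.exists_mul_eq_one_of_rank_eq_card hB
  funext a
  calc x a = ∑ s, (B * R) s a • x s := by simp [hR, Matrix.one_apply]
    _ = ∑ j, R j a • ∑ s, B s j • x s := by
        simp only [Matrix.mul_apply, Finset.sum_smul, Finset.smul_sum, smul_smul]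
        rw [Finset.sum_comm]
        simp only [mul_comm]
    _ = 0 := by simp [hx]

/-- If every nonzero codeword of the code with parity-check matrix `H`
has sum-rank weight at least `d`, and `B = diag(B⁽¹⁾,…,B⁽ˡ⁾)` is a block-diagonal support
basis with rank profile `(t₁,…,t_ℓ)` and `t = t₁+⋯+t_ℓ ≤ d − 1`, then `H·Bᵀ` has full
column rank `t` over `F_{q^m}`. -/
theorem stmt1 (q m n k d ℓ : ℕ) (Fq K : Type) [Field Fq] [Fintype Fq] [Field K] [Fintype K]
    [Algebra Fq K]
    (hq : Fintype.card Fq = q) (hK : Fintype.card K = q ^ m)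
    (hm : 1 ≤ m) (hl : 1 ≤ ℓ)
    (nn : Fin ℓ → ℕ) (hnn : ∀ i, 1 ≤ nn i) (hn : n = ∑ i, nn i)
    (H : Matrix (Fin (n - k)) ((i : Fin ℓ) × Fin (nn i)) K)
    (hdist : ∀ c : ((i : Fin ℓ) × Fin (nn i)) → K, c ≠ 0 → H *ᵥ c = 0 →
      d ≤ ∑ i, Module.finrank Fq
            (Submodule.span Fq (Set.range fun j : Fin (nn i) => c ⟨i, j⟩)))
    (tt : Fin ℓ → ℕ) (t : ℕ) (htdef : t = ∑ i, tt i)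
    (Bb : ∀ i, Matrix (Fin (tt i)) (Fin (nn i)) Fq)
    (hBrank : ∀ i, (Bb i).rank = tt i)
    (htd : t + 1 ≤ d) :
    (H * ((Matrix.blockDiagonal' Bb).map (algebraMap Fq K))ᵀ).rank = t := by
  have hker : ∀ x, (H * ((Matrix.blockDiagonal' Bb).map (algebraMap Fq K))ᵀ) *ᵥ x = 0 →
      x = 0 := by
    intro x hx
    have hc : ((Matrix.blockDiagonal' Bb).map (algebraMap Fq K))ᵀ *ᵥ x = 0 := by
      by_contra hc
      have hd := hdist _ hc (by rwa [Matrix.mulVec_mulVec])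
      have hle := hd.trans (Finset.sum_le_sum (g := tt) fun i _ => by
        rw [funext fun j => Matrix.blockDiagonal'_map_transpose_mulVec_apply Bb x i j]
        simpa using finrank_span_range_sum_smul_le (Bb i) fun s => x ⟨i, s⟩)
      omega
    funext ⟨i, s⟩
    refine congrFun (eq_zero_of_sum_smul_eq_zero_of_rank_eq_card (B := Bb i)
      (x := fun s => x ⟨i, s⟩) (by simpa using hBrank i) fun j => ?_) s
    rw [← Matrix.blockDiagonal'_map_transpose_mulVec_apply Bb x i j, hc, Pi.zero_apply]
  rw [Matrix.rank_eq_card_of_forall_mulVec_eq_zero hker, htdef]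
  simp
end

section
/- Let H ∈ F_{q^m}^{(n−k)×n} with rank_{q^m}(H) = n−k, and let E ∈ F_{q^m}^{s×n} with rank_{q^m}(E) = t, where t ≤ n−k−1. Let C := {x ∈ F_{q^m}^n : H·xᵀ = 0} and assume that the F_{q^m}-row space of E intersects C trivially. Set S := H·Eᵀ ∈ F_{q^m}^{(n−k)×s}, and let P ∈ F_{q^m}^{(n−k)×(n−k)} be an invertible matrix such that the last n−k−t rows of P·S are zero. Then: (a) rank_{q^m}(S) = t; and (b) the matrix H_S ∈ F_{q^m}^{(n−k−t)×n} formed by the last n−k−t rows of P·H satisfies rank_{q^m}(H_S) = n−k−t, H_S·Eᵀ = 0, and H_S·xᵀ = 0 for every x ∈ C (i.e., H_S is a parity-check matrix of the code C + rowspace(E)). -/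
open Matrix

/-- Multiplying on the left by a matrix whose kernel meets the column space of the right factor
trivially preserves the rank. -/
theorem Matrix.rank_mul_eq_right_of_disjoint_ker {K l m n : Type*} [Field K] [Fintype m]
    [Fintype n] (A : Matrix l m K) (B : Matrix m n K)
    (h : LinearMap.range B.mulVecLin ⊓ LinearMap.ker A.mulVecLin = ⊥) :
    (A * B).rank = B.rank := by
  rw [Matrix.rank, Matrix.mulVecLin_mul, LinearMap.range_comp, ← LinearMap.range_domRestrict]
  refine LinearMap.finrank_range_of_inj (LinearMap.ker_eq_bot.mp ?_)
  rw [LinearMap.ker_eq_bot']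
  rintro ⟨x, hx⟩ hAx
  have hx0 : x ∈ (⊥ : Submodule K (m → K)) := h ▸ ⟨hx, hAx⟩
  exact Subtype.ext hx0

/-- The rows of a matrix over a field whose rank equals its number of rows are linearly
independent. -/
theorem Matrix.linearIndependent_row_of_rank_eq_card {K m n : Type*} [Field K] [Fintype m]
    [Fintype n] (A : Matrix m n K) (h : A.rank = Fintype.card m) :
    LinearIndependent K A.row := by
  rw [linearIndependent_iff_card_eq_finrank_span, Set.finrank, ← A.rank_eq_finrank_span_row, h]

/-- computing a parity-check matrix of `C + rowspace(E)` from the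
syndrome, Theorem 2 of the paper. -/
theorem stmt4 (q m n k t s : ℕ) (Fq K : Type) [Field Fq] [Fintype Fq] [Field K] [Fintype K]
    [Algebra Fq K]
    (hq : Fintype.card Fq = q) (hK : Fintype.card K = q ^ m)
    (hm : 1 ≤ m) (hs : 1 ≤ s)
    (H : Matrix (Fin (n - k)) (Fin n) K) (hHrank : H.rank = n - k)
    (E : Matrix (Fin s) (Fin n) K) (hErank : E.rank = t) (ht : t ≤ n - k - 1)
    (hint : Submodule.span K (Set.range E) ⊓ LinearMap.ker H.mulVecLin = ⊥)
    (S : Matrix (Fin (n - k)) (Fin s) K) (hS : S = H * Eᵀ)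
    (P : Matrix (Fin (n - k)) (Fin (n - k)) K) (hP : IsUnit P)
    (hPS : ∀ r : Fin (n - k), t ≤ (r : ℕ) → ∀ c, (P * S) r c = 0)
    (HS : Matrix (Fin (n - k - t)) (Fin n) K)
    (hHS : ∀ (r : Fin (n - k - t)) (c : Fin n),
        HS r c = (P * H) ⟨t + r.1, by have := r.isLt; omega⟩ c) :
    S.rank = t ∧ HS.rank = n - k - t ∧ HS * Eᵀ = 0 ∧
      ∀ x : Fin n → K, H *ᵥ x = 0 → HS *ᵥ x = 0 := by
  have hHS' : HS = (P * H).submatrix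
      (fun r : Fin (n - k - t) => (⟨t + r.1, by have := r.isLt; omega⟩ : Fin (n - k))) id := by
    ext r c
    exact hHS r c
  refine ⟨?_, ?_, ?_, fun x hx => ?_⟩
  · rw [hS, Matrix.rank_mul_eq_right_of_disjoint_ker, Matrix.rank_transpose, hErank]
    rw [Matrix.range_mulVecLin]
    exact hint
  · have hPH : (P * H).rank = Fintype.card (Fin (n - k)) := by
      rw [Matrix.rank_mul_eq_right_of_isUnit_det P H ((Matrix.isUnit_iff_isUnit_det P).mp hP),
        hHrank, Fintype.card_fin]
    have hrow : LinearIndependent K HS.row := by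
      rw [hHS']
      refine ((P * H).linearIndependent_row_of_rank_eq_card hPH).comp _ fun a b hab => ?_
      simpa [Fin.ext_iff] using hab
    rw [hrow.rank_matrix, Fintype.card_fin]
  · ext r c
    have hzero := hPS ⟨t + r.1, by have := r.isLt; omega⟩ (Nat.le_add_right _ _) c
    rw [hS, ← Matrix.mul_assoc] at hzero
    rw [hHS']
    exact hzero
  · have hPHx : (P * H) *ᵥ x = 0 := by
      rw [← Matrix.mulVec_mulVec, hx, Matrix.mulVec_zero]
    ext r
    rw [hHS']
    exact congrFun hPHx _
end

section
/- Fix a length partition n = n_1 + ... + n_ℓ and nonnegative integers t_1,...,t_ℓ (a rank profile), and let t := t_1+...+t_ℓ. Then the following counting identity holds: #{E ∈ F_{q^m}^{s×n} : rank_q(E^{(i)}) = t_i for all i and rank_{q^m}(E) = t} · ∏_{i=1}^ℓ ∏_{j=0}^{t_i−1}(q^{sm} − q^{j}) = #{E ∈ F_{q^m}^{s×n} : rank_q(E^{(i)}) = t_i for all i} · ∏_{j=0}^{t−1}(q^{sm} − q^{jm}). (Equivalently, for an error matrix drawn uniformly at random among those with rank profile (t_1,...,t_ℓ), the probability that rank_{q^m}(E)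 = t equals ∏_{j=0}^{t−1}(q^{sm} − q^{jm}) / ∏_{i=1}^ℓ ∏_{j=0}^{t_i−1}(q^{sm} − q^{j}).) -/
open Matrix Finset

/-- `F_q`-rank of the `i`-th column block of `E`. -/
noncomputable def blockRankq (Fq : Type) [Field Fq] {K : Type} [Field K] [Algebra Fq K]
    {s ℓ : ℕ} {nn : Fin ℓ → ℕ} (E : Matrix (Fin s) ((i : Fin ℓ) × Fin (nn i)) K)
    (i : Fin ℓ) : ℕ :=
  Module.finrank Fq
    (Submodule.span Fq (Set.range fun j : Fin (nn i) => fun r : Fin s => E r ⟨i, j⟩))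

theorem card_linearIndependent_eq_prod (F V : Type*) [Field F] [Fintype F] [AddCommGroup V]
    [Module F V] [Finite V] (k : ℕ) :
    (Nat.card {a : Fin k → V // LinearIndependent F a} : ℤ) =
      ∏ j ∈ Finset.range k, ((Nat.card V : ℤ) - (Fintype.card F : ℤ) ^ j) := by
  have hV : Nat.card V = Fintype.card F ^ Module.finrank F V := by
    rw [Module.natCard_eq_pow_finrank (K := F), Nat.card_eq_fintype_card]
  rcases le_or_gt k (Module.finrank F V) with h | h
  · rw [card_linearIndependent h, Nat.cast_prod, ← Fin.prod_univ_eq_prod_range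
      (fun j => (Nat.card V : ℤ) - (Fintype.card F : ℤ) ^ j), hV]
    refine Finset.prod_congr rfl fun j _ => ?_
    rw [Nat.cast_sub (Nat.pow_le_pow_right Fintype.card_pos (j.2.le.trans h))]
    push_cast
    rfl
  · have : IsEmpty {a : Fin k → V // LinearIndependent F a} :=
      ⟨fun a => by simpa using a.2.fintype_card_le_finrank.trans_lt h⟩
    rw [Nat.card_of_isEmpty, Nat.cast_zero,
      Finset.prod_eq_zero (Finset.mem_range.2 h) (by simp [hV])]

/-- The number of families spanning a given subspace depends only on its dimension. -/
theorem card_span_range_eq {F V : Type*} [Field F] [AddCommGroup V] [Module F V] [Finite V]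
    (ι : Type*) {t : ℕ} (U : Submodule F V) (hU : Module.finrank F U = t) :
    Nat.card {f : ι → V // Submodule.span F (Set.range f) = U} =
      Nat.card {g : ι → Fin t → F // Submodule.span F (Set.range g) = ⊤} := by
  let e : U ≃ₗ[F] (Fin t → F) := LinearEquiv.ofFinrankEq _ _ (by simpa using hU)
  have key (g : ι → U) : Submodule.span F (Set.range fun i => (g i : V)) =
      (Submodule.span F (Set.range g)).map U.subtype := by
    rw [Submodule.map_span, ← Set.range_comp]
    rfl
  have key' (g : ι → U) : Submodule.span F (Set.range fun i => e (g i)) =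
      (Submodule.span F (Set.range g)).map e.toLinearMap := by
    rw [Submodule.map_span, ← Set.range_comp]
    rfl
  have h1 (g : ι → U) : Submodule.span F (Set.range fun i => (g i : V)) = U ↔
      Submodule.span F (Set.range g) = ⊤ := by
    rw [key]
    constructor
    · intro h
      apply Submodule.map_injective_of_injective U.injective_subtype
      rw [h, Submodule.map_subtype_top]
    · intro h
      rw [h, Submodule.map_subtype_top]
  have h2 (g : ι → U) : Submodule.span F (Set.range fun i => e (g i)) = ⊤ ↔
      Submodule.span F (Set.range g) = ⊤ := by
    rw [key']
    exact map_eq_top_iff (Submodule.orderIsoMapComap e)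
  symm
  refine Nat.card_congr (Equiv.ofBijective
    (fun g => ⟨fun i => (e.symm (g.1 i) : V), ?_⟩) ⟨?_, ?_⟩)
  · rw [h1, ← h2]
    simpa using g.2
  · intro g g' h
    ext1
    funext i
    have := congrFun (congrArg Subtype.val h) i
    exact e.symm.injective (Subtype.ext this)
  · rintro ⟨f, hf⟩
    have hm (i : ι) : f i ∈ U := hf ▸ Submodule.subset_span ⟨i, rfl⟩
    refine ⟨⟨fun i => e ⟨f i, hm i⟩, ?_⟩, ?_⟩
    · exact (h2 fun i => ⟨f i, hm i⟩).2 ((h1 fun i => ⟨f i, hm i⟩).1 hf)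
    · ext1
      funext i
      simp

/-- Families of tuples, counted through the tuple of subspaces that they span. -/
theorem card_span_range_family {F V : Type*} [Field F] [Fintype F] [AddCommGroup V] [Module F V]
    [Finite V] {ι : Type*} [Fintype ι] (n t : ι → ℕ) (P : (ι → Submodule F V) → Prop)
    (hP : ∀ U, P U → ∀ i, Module.finrank F (U i) = t i) :
    Nat.card {f : (i : ι) → Fin (n i) → V // P fun i => Submodule.span F (Set.range (f i))} =
      Nat.card {U // P U} * ∏ i, Nat.card {g : Fin (n i) → Fin (t i) → F //
        Submodule.span F (Set.range g) = ⊤} := by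
  classical
  let φ (f : {f : (i : ι) → Fin (n i) → V // P fun i => Submodule.span F (Set.range (f i))}) :
      {U // P U} := ⟨_, f.2⟩
  have : Fintype {U : ι → Submodule F V // P U} := Fintype.ofFinite _
  rw [Nat.card_congr (Equiv.sigmaFiberEquiv φ).symm, Nat.card_sigma,
    Finset.sum_congr rfl (g := fun _ => ∏ i, Nat.card {g : Fin (n i) → Fin (t i) → F //
        Submodule.span F (Set.range g) = ⊤}), Finset.sum_const, smul_eq_mul, Finset.card_univ,
    Nat.card_eq_fintype_card]
  rintro ⟨U, hU⟩ -
  rw [Finset.prod_congr rfl fun i _ =>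
    (card_span_range_eq (Fin (n i)) (U i) (hP U hU i)).symm, ← Nat.card_pi]
  refine Nat.card_congr
    { toFun := fun f i => ⟨f.1.1 i, congrFun (congrArg Subtype.val f.2) i⟩
      invFun := fun f => ⟨⟨fun i => (f i).1, by simpa only [(f _).2] using hU⟩,
        Subtype.ext (funext fun i => (f i).2)⟩
      left_inv := fun _ => rfl
      right_inv := fun _ => rfl }

theorem span_iUnion_span_range {F K V ι : Type*} {κ : ι → Type*} [Field F] [Field K] [Algebra F K]
    [AddCommGroup V] [Module F V] [Module K V] [IsScalarTower F K V] (f : (i : ι) → κ i → V) :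
    Submodule.span K (⋃ i, (Submodule.span F (Set.range (f i)) : Set V)) =
      Submodule.span K (Set.range fun p : (i : ι) × κ i => f p.1 p.2) := by
  rw [Submodule.span_iUnion]
  simp_rw [Submodule.span_span_of_tower]
  rw [← Submodule.span_iUnion]
  congr 1
  ext x
  simp

theorem linearIndependent_sigma_iff {F K V ι : Type*} [Fintype ι] [Field F] [Field K] [Algebra F K]
    [AddCommGroup V] [Module F V] [Module K V] [IsScalarTower F K V] (t : ι → ℕ)
    (f : (i : ι) → Fin (t i) → V) :
    ((∀ i, Module.finrank F (Submodule.span F (Set.range (f i))) = t i) ∧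
      Module.finrank K (Submodule.span K
        (⋃ i, (Submodule.span F (Set.range (f i)) : Set V))) = ∑ i, t i) ↔
      LinearIndependent K fun p : (i : ι) × Fin (t i) => f p.1 p.2 := by
  rw [span_iUnion_span_range, linearIndependent_iff_card_eq_finrank_span, Fintype.card_sigma]
  simp only [Fintype.card_fin, Set.finrank]
  refine ⟨fun h => h.2.symm, fun h => ⟨fun i => ?_, h.symm⟩⟩
  have hK : LinearIndependent K fun p : (i : ι) × Fin (t i) => f p.1 p.2 := by
    rw [linearIndependent_iff_card_eq_finrank_span, Fintype.card_sigma]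
    simpa only [Fintype.card_fin, Set.finrank] using h
  have hF : LinearIndependent F (f i) :=
    (hK.restrict_scalars' F).comp (Sigma.mk i) sigma_mk_injective
  simpa using finrank_span_eq_card hF

/-- Lemma 3 of the paper. For a fixed rank profile `(t₁,…,t_ℓ)` with
`t = Σ tᵢ`, the number of matrices with that rank profile and full `F_{q^m}`-rank `t`,
times `∏ᵢ∏_{j<tᵢ}(q^{sm}−q^j)`, equals the number of matrices with that rank profile,
times `∏_{j<t}(q^{sm}−q^{jm})`. -/
theorem stmt7 (q m s ℓ : ℕ) (Fq K : Type) [Field Fq] [Fintype Fq] [Field K] [Fintype K]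
    [Algebra Fq K]
    (hq : Fintype.card Fq = q) (hK : Fintype.card K = q ^ m)
    (hm : 1 ≤ m) (hs : 1 ≤ s) (hl : 1 ≤ ℓ)
    (nn : Fin ℓ → ℕ) (hnn : ∀ i, 1 ≤ nn i)
    (tt : Fin ℓ → ℕ) :
    (Nat.card {E : Matrix (Fin s) ((i : Fin ℓ) × Fin (nn i)) K //
        (∀ i, blockRankq Fq E i = tt i) ∧ E.rank = ∑ i, tt i} : ℤ) *
      ∏ i, ∏ j ∈ Finset.range (tt i), ((q : ℤ) ^ (s * m) - (q : ℤ) ^ j)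
    = (Nat.card {E : Matrix (Fin s) ((i : Fin ℓ) × Fin (nn i)) K //
        ∀ i, blockRankq Fq E i = tt i} : ℤ) *
      ∏ j ∈ Finset.range (∑ i, tt i), ((q : ℤ) ^ (s * m) - (q : ℤ) ^ (j * m)) := by
  have hV : Nat.card (Fin s → K) = q ^ (s * m) := by
    rw [Nat.card_eq_fintype_card, Fintype.card_fun, hK, Fintype.card_fin, ← pow_mul, mul_comm]
  let P₀ (U : Fin ℓ → Submodule Fq (Fin s → K)) : Prop := ∀ i, Module.finrank Fq (U i) = tt i
  let P₁ (U : Fin ℓ → Submodule Fq (Fin s → K)) : Prop :=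
    P₀ U ∧ Module.finrank K (Submodule.span K (⋃ i, (U i : Set (Fin s → K)))) = ∑ i, tt i
  have hP₁ (U) (hU : P₁ U) : P₀ U := hU.1
  let e : Matrix (Fin s) ((i : Fin ℓ) × Fin (nn i)) K ≃ ((i : Fin ℓ) → Fin (nn i) → Fin s → K) :=
    { toFun := fun E i j r => E r ⟨i, j⟩
      invFun := fun f r p => f p.1 p.2 r
      left_inv := fun _ => rfl
      right_inv := fun _ => rfl }
  have hE₀ : Nat.card {E : Matrix (Fin s) ((i : Fin ℓ) × Fin (nn i)) K //
      ∀ i, blockRankq Fq E i = tt i} =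
      Nat.card {f : (i : Fin ℓ) → Fin (nn i) → Fin s → K //
        P₀ fun i => Submodule.span Fq (Set.range (f i))} :=
    Nat.card_congr (e.subtypeEquiv fun _ => Iff.rfl)
  have hE₁ : Nat.card {E : Matrix (Fin s) ((i : Fin ℓ) × Fin (nn i)) K //
      (∀ i, blockRankq Fq E i = tt i) ∧ E.rank = ∑ i, tt i} =
      Nat.card {f : (i : Fin ℓ) → Fin (nn i) → Fin s → K //
        P₁ fun i => Submodule.span Fq (Set.range (f i))} := by
    refine Nat.card_congr (e.subtypeEquiv fun E => and_congr Iff.rfl ?_)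
    rw [span_iUnion_span_range, Matrix.rank_eq_finrank_span_cols]
    rfl
  have hA₀ : (Nat.card {f : (i : Fin ℓ) → Fin (tt i) → Fin s → K //
        P₀ fun i => Submodule.span Fq (Set.range (f i))} : ℤ) =
      ∏ i, ∏ j ∈ Finset.range (tt i), ((q : ℤ) ^ (s * m) - (q : ℤ) ^ j) := by
    have h (i : Fin ℓ) := card_linearIndependent_eq_prod Fq (Fin s → K) (tt i)
    simp only [hV, hq, Nat.cast_pow] at h
    simp_rw [← h]
    rw [← Nat.cast_prod, ← Nat.card_pi]
    congr 1
    refine Nat.card_congr ((Equiv.subtypeEquivRight fun f => ?_).trans Equiv.subtypePiEquivPi)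
    refine forall_congr' fun i => ?_
    rw [linearIndependent_iff_card_eq_finrank_span, Fintype.card_fin, eq_comm]
    rfl
  have hA₁ : (Nat.card {f : (i : Fin ℓ) → Fin (tt i) → Fin s → K //
        P₁ fun i => Submodule.span Fq (Set.range (f i))} : ℤ) =
      ∏ j ∈ Finset.range (∑ i, tt i), ((q : ℤ) ^ (s * m) - (q : ℤ) ^ (j * m)) := by
    have h := card_linearIndependent_eq_prod K (Fin s → K) (∑ i, tt i)
    simp only [hV, hK, Nat.cast_pow, ← pow_mul, mul_comm m] at h
    rw [← h]
    congr 1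
    refine Nat.card_congr (((Equiv.piCurry _).symm.trans
      (Equiv.arrowCongr finSigmaFinEquiv (Equiv.refl _))).subtypeEquiv fun f => ?_)
    refine (linearIndependent_sigma_iff tt f).trans ?_
    exact (linearIndependent_equiv finSigmaFinEquiv.symm).symm
  rw [← hA₀, ← hA₁, hE₀, hE₁, card_span_range_family nn tt P₀ fun _ h => h,
    card_span_range_family nn tt P₁ hP₁, card_span_range_family tt tt P₀ fun _ h => h,
    card_span_range_family tt tt P₁ hP₁]
  push_cast
  ring
end

section
/- Suppose the length partition has constant block lengths n_i = η for all i, so n = ℓη, and set μ := min(sm, η). Then for every t ≥ 0: #{E ∈ F_{q^m}^{s×n} : srw(E) = t and rank_{q^m}(E) = t} = (∏_{j=0}^{t−1}(q^{sm} − q^{jm})) · Σ_{(t_1,...,t_ℓ)} ∏_{i=1}^ℓ G_q(η, t_i), where the sum ranges over all tuples (t_1,...,t_ℓ) of integers with 0 ≤ t_i ≤ μ and t_1+...+t_ℓ = t. -/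
open Matrix Finset

/-- Sum-rank weight of `E ∈ F_{q^m}^{s×(ℓη)}` for constant block length `η`:
the sum over the blocks of the `F_q`-dimension of the span of the block's columns. -/
noncomputable def srw (Fq : Type) [Field Fq] {K : Type} [Field K] [Algebra Fq K]
    {s ℓ η : ℕ} (E : Matrix (Fin s) (Fin ℓ × Fin η) K) : ℕ :=
  ∑ i : Fin ℓ, Module.finrank Fq
    (Submodule.span Fq (Set.range fun j : Fin η => fun r : Fin s => E r (i, j)))

/-- `G_q(η, d)`: the number of `d`-dimensional `F_q`-subspaces of `F_q^η`. -/
noncomputable def Gq (Fq : Type) [Field Fq] (η d : ℕ) : ℕ :=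
  Nat.card {W : Submodule Fq (Fin η → Fq) // Module.finrank Fq W = d}

open Module

/-- The `F`-linear map `F^η → K^s` whose values on the standard basis are the columns of the
`i`-th block of `E`. -/
noncomputable def blockMap (F : Type) [Field F] {K : Type} [Field K] [Algebra F K]
    {s ℓ η : ℕ} (E : Matrix (Fin s) (Fin ℓ × Fin η) K) (i : Fin ℓ) :
    (Fin η → F) →ₗ[F] (Fin s → K) :=
  Fintype.linearCombination F fun j r => E r (i, j)

section BlockMap

variable {F K : Type} [Field F] [Field K] [Algebra F K] {s ℓ η : ℕ}

lemma srw_eq_sum_finrank_quotient_ker (E : Matrix (Fin s) (Fin ℓ × Fin η) K) :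
    srw F E = ∑ i, finrank F ((Fin η → F) ⧸ LinearMap.ker (blockMap F E i)) := by
  unfold srw
  refine Finset.sum_congr rfl fun i _ => ?_
  rw [← Fintype.range_linearCombination]
  exact (blockMap F E i).quotKerEquivRange.finrank_eq.symm

lemma blockMap_apply (E : Matrix (Fin s) (Fin ℓ × Fin η) K) (i : Fin ℓ) (x : Fin η → F)
    (r : Fin s) : blockMap F E i x r = ∑ j, x j • E r (i, j) := by
  simp [blockMap, Fintype.linearCombination_apply]

lemma blockMap_injective :
    Function.Injective fun (E : Matrix (Fin s) (Fin ℓ × Fin η) K) => blockMap F E := by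
  intro E E' h
  ext r ⟨i, j⟩
  have := congrFun (LinearMap.congr_fun (congrFun h i) (Pi.single j 1)) r
  simpa [blockMap] using this

variable {d : Fin ℓ → ℕ}

/-- The block-diagonal matrix over `K` with diagonal blocks `B i`. -/
def blockDiagLeft (K : Type) [Field K] [Algebra F K] (B : ∀ i, Matrix (Fin (d i)) (Fin η) F) :
    Matrix (Σ i, Fin (d i)) (Fin ℓ × Fin η) K :=
  Matrix.of fun p x => if p.1 = x.1 then algebraMap F K (B p.1 p.2 x.2) else 0

/-- The block-diagonal matrix over `K` with diagonal blocks `C i`, in the transposed shape of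
`blockDiagLeft`. -/
def blockDiagRight (K : Type) [Field K] [Algebra F K]
    (C : ∀ i, Matrix (Fin η) (Fin (d i)) F) :
    Matrix (Fin ℓ × Fin η) (Σ i, Fin (d i)) K :=
  Matrix.of fun x p => if x.1 = p.1 then algebraMap F K (C p.1 x.2 p.2) else 0

lemma blockDiagLeft_mul_blockDiagRight {B : ∀ i, Matrix (Fin (d i)) (Fin η) F}
    {C : ∀ i, Matrix (Fin η) (Fin (d i)) F} (h : ∀ i, B i * C i = 1) :
    blockDiagLeft K B * blockDiagRight K C = 1 := by
  ext ⟨i, k⟩ ⟨i', k'⟩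
  rw [Matrix.mul_apply, Fintype.sum_prod_type]
  simp only [blockDiagLeft, blockDiagRight, Matrix.of_apply]
  rw [Finset.sum_eq_single i (by intro b _ hb; simp [hb.symm]) (by simp)]
  by_cases hi : i = i'
  · subst hi
    have := congrArg (algebraMap F K) (congrFun (congrFun (h i) k) k')
    rw [Matrix.mul_apply, map_sum] at this
    simp only [if_true, ← map_mul, this]
    by_cases hk : k = k' <;> simp [hk, Matrix.one_apply]
  · simp [hi]

lemma blockMap_mul_blockDiagLeft (A : Matrix (Fin s) (Σ i, Fin (d i)) K)
    (B : ∀ i, Matrix (Fin (d i)) (Fin η) F) (i : Fin ℓ) (x : Fin η → F) :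
    blockMap F (A * blockDiagLeft K B) i x =
      Fintype.linearCombination F (fun k => A.col ⟨i, k⟩) (B i *ᵥ x) := by
  ext r
  simp only [blockMap_apply, Fintype.linearCombination_apply, Matrix.mul_apply,
    Fintype.sum_sigma, blockDiagLeft, Matrix.of_apply, Matrix.col_apply, Finset.sum_apply, Pi.smul_apply]
  have (j : Fin η) : (∑ i', ∑ k : Fin (d i'), A r ⟨i', k⟩ *
      (if i' = i then algebraMap F K (B i' k j) else 0)) =
      ∑ k : Fin (d i), A r ⟨i, k⟩ * algebraMap F K (B i k j) := by
    rw [Finset.sum_eq_single i (by intro b _ hb; simp [hb]) (by simp)]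
    simp
  simp only [this, Matrix.mulVec, dotProduct, Finset.smul_sum, Finset.sum_smul]
  rw [Finset.sum_comm]
  refine Finset.sum_congr rfl fun k _ => Finset.sum_congr rfl fun j _ => ?_
  simp only [Algebra.smul_def, map_mul]
  ring

lemma linearCombination_mul_blockDiagRight (E : Matrix (Fin s) (Fin ℓ × Fin η) K)
    (C : ∀ i, Matrix (Fin η) (Fin (d i)) F) (i : Fin ℓ) (y : Fin (d i) → F) :
    Fintype.linearCombination F (fun k => (E * blockDiagRight K C).col ⟨i, k⟩) y =
      blockMap F E i (C i *ᵥ y) := by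
  ext r
  simp only [blockMap_apply, Fintype.linearCombination_apply, Matrix.mul_apply,
    Fintype.sum_prod_type, blockDiagRight, Matrix.of_apply, Matrix.col_apply, Finset.sum_apply, Pi.smul_apply]
  have (k : Fin (d i)) : (∑ i', ∑ j, E r (i', j) *
      (if i' = i then algebraMap F K (C i j k) else 0)) =
      ∑ j, E r (i, j) * algebraMap F K (C i j k) := by
    rw [Finset.sum_eq_single i (by intro b _ hb; simp [hb]) (by simp)]
    simp
  simp only [this, Matrix.mulVec, dotProduct, Finset.smul_sum, Finset.sum_smul]
  rw [Finset.sum_comm]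
  refine Finset.sum_congr rfl fun k _ => Finset.sum_congr rfl fun j _ => ?_
  simp only [Algebra.smul_def, map_mul]
  ring

/-- Every subspace of `F^η` of codimension `d` is the kernel of a right-invertible `d × η`
matrix. -/
lemma exists_matrix_ker (W : Submodule F (Fin η → F)) {d : ℕ}
    (h : finrank F ((Fin η → F) ⧸ W) = d) :
    ∃ (B : Matrix (Fin d) (Fin η) F) (C : Matrix (Fin η) (Fin d) F),
      B * C = 1 ∧ ∀ x, B *ᵥ x = 0 ↔ x ∈ W := by
  let e : ((Fin η → F) ⧸ W) ≃ₗ[F] (Fin d → F) := LinearEquiv.ofFinrankEq _ _ (by simpa using h)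
  let f := e.toLinearMap ∘ₗ W.mkQ
  obtain ⟨g, hg⟩ := f.exists_rightInverse_of_surjective
    (LinearMap.range_eq_top.2 (e.surjective.comp W.mkQ_surjective))
  refine ⟨LinearMap.toMatrix' f, LinearMap.toMatrix' g, ?_, fun x => ?_⟩
  · rw [← LinearMap.toMatrix'_comp, hg, LinearMap.toMatrix'_id]
  · rw [LinearMap.toMatrix'_mulVec]
    simp [f]

lemma rank_eq_card_iff_linearIndependent_col {ι : Type} [Fintype ι] (A : Matrix (Fin s) ι K) :
    A.rank = Fintype.card ι ↔ LinearIndependent K A.col := by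
  rw [linearIndependent_iff_card_eq_finrank_span, Matrix.rank_eq_finrank_span_cols, eq_comm]
  rfl

lemma card_matrix_linearIndependent_col [Fintype K] {ι : Type} [Fintype ι] :
    (Nat.card {A : Matrix (Fin s) ι K // LinearIndependent K A.col} : ℤ) =
      ∏ j ∈ Finset.range (Fintype.card ι),
        ((Fintype.card K : ℤ) ^ s - (Fintype.card K : ℤ) ^ j) := by
  let e : {A : Matrix (Fin s) ι K // LinearIndependent K A.col} ≃
      {v : Fin (Fintype.card ι) → (Fin s → K) // LinearIndependent K v} :=
    { toFun := fun A => ⟨A.1.col ∘ (Fintype.equivFin ι).symm,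
        A.2.comp _ (Fintype.equivFin ι).symm.injective⟩
      invFun := fun v => ⟨Matrix.of fun r k => v.1 (Fintype.equivFin ι k) r,
        v.2.comp _ (Fintype.equivFin ι).injective⟩
      left_inv := fun A => by ext; simp
      right_inv := fun v => by ext; simp }
  rw [Nat.card_congr e]
  rcases le_or_gt (Fintype.card ι) s with h | h
  · rw [card_linearIndependent (by simpa using h), ← Fin.prod_univ_eq_prod_range
      (fun j => ((Fintype.card K : ℤ) ^ s - (Fintype.card K : ℤ) ^ j)), Nat.cast_prod]
    refine Finset.prod_congr rfl fun j _ => ?_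
    rw [Nat.cast_sub (Nat.pow_le_pow_right Fintype.card_pos (by simp; omega))]
    simp
  · rw [Finset.prod_eq_zero (Finset.mem_range.2 h) (sub_self _)]
    have : IsEmpty {v : Fin (Fintype.card ι) → (Fin s → K) // LinearIndependent K v} :=
      ⟨fun v => h.not_ge (by simpa using v.2.fintype_card_le_finrank)⟩
    simp

/-- The number of matrices of rank `t` whose blocks have prescribed kernels over `F` of
codimensions adding up to `t`. -/
lemma card_blockMap_ker_eq [Fintype K] (W : Fin ℓ → Submodule F (Fin η → F)) {t : ℕ}
    (hW : ∑ i, finrank F ((Fin η → F) ⧸ W i) = t) :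
    (Nat.card {E : Matrix (Fin s) (Fin ℓ × Fin η) K //
        (fun i => LinearMap.ker (blockMap F E i)) = W ∧ E.rank = t} : ℤ) =
      ∏ j ∈ Finset.range t, ((Fintype.card K : ℤ) ^ s - (Fintype.card K : ℤ) ^ j) := by
  choose B C hBC hB using fun i => exists_matrix_ker (W i) rfl
  have hι : Fintype.card (Σ i, Fin (finrank F ((Fin η → F) ⧸ W i))) = t := by simpa using hW
  have hBC' : blockDiagLeft K B * blockDiagRight K C = 1 := blockDiagLeft_mul_blockDiagRight hBC
  have hrank (A : Matrix (Fin s) (Σ i, Fin (finrank F ((Fin η → F) ⧸ W i))) K) :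
      (A * blockDiagLeft K B).rank = A.rank := by
    refine le_antisymm (Matrix.rank_mul_le_left _ _) ?_
    conv_lhs => rw [← Matrix.mul_one A, ← hBC', ← Matrix.mul_assoc]
    exact Matrix.rank_mul_le_left _ _
  have hfac (E : Matrix (Fin s) (Fin ℓ × Fin η) K)
      (hE : (fun i => LinearMap.ker (blockMap F E i)) = W) :
      E * blockDiagRight K C * blockDiagLeft K B = E := by
    apply blockMap_injective (F := F)
    funext i
    refine LinearMap.ext fun x => ?_
    beta_reduce
    rw [blockMap_mul_blockDiagLeft, linearCombination_mul_blockDiagRight E C i, ← sub_eq_zero, ← map_sub,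
      ← LinearMap.mem_ker, congrFun hE i, ← hB, Matrix.mulVec_sub, Matrix.mulVec_mulVec, hBC,
      Matrix.one_mulVec, sub_self]
  rw [← hι, ← card_matrix_linearIndependent_col, Nat.cast_inj]
  symm
  refine Nat.card_congr
    { toFun := fun A => ⟨A.1 * blockDiagLeft K B, ?_, ?_⟩
      invFun := fun E => ⟨E.1 * blockDiagRight K C, ?_⟩
      left_inv := fun A => Subtype.ext ?_
      right_inv := fun E => Subtype.ext (hfac E.1 E.2.1) }
  · funext i
    ext x
    have hli : LinearIndependent F fun k => A.1.col ⟨i, k⟩ :=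
      (A.2.comp (fun k => (⟨i, k⟩ : Σ i, Fin (finrank F ((Fin η → F) ⧸ W i))))
        fun _ _ h => eq_of_heq (Sigma.mk.inj h).2).restrict_scalars' F
    rw [LinearMap.mem_ker, blockMap_mul_blockDiagLeft, ← hB]
    exact map_eq_zero_iff _ (linearIndependent_iff_injective_fintypeLinearCombination.1 hli)
  · rw [hrank, rank_eq_card_iff_linearIndependent_col]
    exact A.2
  · rw [← rank_eq_card_iff_linearIndependent_col, ← hrank, hfac E.1 E.2.1]
    exact E.2.2
  · change A.1 * blockDiagLeft K B * blockDiagRight K C = A.1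
    rw [Matrix.mul_assoc, hBC', Matrix.mul_one]

end BlockMap

lemma card_finrank_quotient_eq (F : Type) [Field F] (η d : ℕ) :
    Nat.card {W : Submodule F (Fin η → F) // finrank F ((Fin η → F) ⧸ W) = d} = Gq F η d := by
  let b : Dual F (Fin η → F) ≃ₗ[F] (Fin η → F) := LinearEquiv.ofFinrankEq _ _ (by simp)
  let e : Submodule F (Fin η → F) ≃ Submodule F (Fin η → F) :=
    (Subspace.orderIsoFiniteDimensional.toEquiv.trans OrderDual.ofDual).trans
      (Submodule.orderIsoMapComap b).toEquiv
  refine Nat.card_congr (e.subtypeEquiv fun W => ?_)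
  have : finrank F (e W) = finrank F ((Fin η → F) ⧸ W) :=
    (b.finrank_map_eq W.dualAnnihilator).trans (Subspace.quotEquivAnnihilator W).finrank_eq.symm
  rw [this]

lemma card_sum_finrank_quotient_eq (F : Type) [Field F] [Fintype F] {ℓ η t M : ℕ}
    (hM : min t η ≤ M) :
    Nat.card {W : Fin ℓ → Submodule F (Fin η → F) //
        ∑ i, finrank F ((Fin η → F) ⧸ W i) = t} =
      ∑ tt ∈ Finset.univ.filter (fun tt : Fin ℓ → Fin (M + 1) => ∑ i, (tt i : ℕ) = t),
        ∏ i, Gq F η (tt i) := by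
  classical
  have := Fintype.ofFinite (Submodule F (Fin η → F))
  have hlt (W : Fin ℓ → Submodule F (Fin η → F))
      (hW : ∑ i, finrank F ((Fin η → F) ⧸ W i) = t) (i : Fin ℓ) :
      finrank F ((Fin η → F) ⧸ W i) < M + 1 := by
    refine Nat.lt_succ_of_le (le_trans (le_min ?_ ?_) hM)
    · rw [← hW]
      exact Finset.single_le_sum (f := fun i => finrank F ((Fin η → F) ⧸ W i))
        (fun _ _ => Nat.zero_le _) (Finset.mem_univ i)
    · simpa using (W i).finrank_quotient_le
  rw [Nat.card_eq_fintype_card, Fintype.card_subtype,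
    Finset.card_eq_sum_card_fiberwise (f := fun W i => Fin.ofNat (M + 1)
      (finrank F ((Fin η → F) ⧸ W i))) (t := Finset.univ.filter
        (fun tt : Fin ℓ → Fin (M + 1) => ∑ i, (tt i : ℕ) = t))]
  · refine Finset.sum_congr rfl fun tt htt => ?_
    have htt : ∑ i, (tt i : ℕ) = t := by simpa using htt
    simp only [← card_finrank_quotient_eq, Nat.card_eq_fintype_card, Fintype.card_subtype]
    rw [← Fintype.card_piFinset]
    congr 1
    ext W
    simp only [Finset.mem_filter, Finset.mem_univ, true_and, Fintype.mem_piFinset]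
    constructor
    · rintro ⟨h, rfl⟩ i
      simp [Nat.mod_eq_of_lt (hlt W h i)]
    · intro h
      refine ⟨by simp [h, htt], funext fun i => Fin.ext ?_⟩
      simp [h]
  · intro W hW
    have hW : ∑ i, finrank F ((Fin η → F) ⧸ W i) = t := by simpa using hW
    simpa [fun i => Nat.mod_eq_of_lt (hlt W hW i)] using hW

/-- Lemma 4 of the paper. For constant block lengths `η` and
`μ = min(sm, η)`, the number of matrices of sum-rank weight `t` satisfying the full-rank
condition equals `(∏_{j<t}(q^{sm}−q^{jm})) · Σ_{(t₁,…,t_ℓ)} ∏ᵢ G_q(η,tᵢ)`, the sum ranging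
over all tuples with `0 ≤ tᵢ ≤ μ` and `Σ tᵢ = t`. -/
theorem stmt8 (q m s ℓ η t : ℕ) (Fq K : Type) [Field Fq] [Fintype Fq] [Field K] [Fintype K]
    [Algebra Fq K]
    (hq : Fintype.card Fq = q) (hK : Fintype.card K = q ^ m)
    (hm : 1 ≤ m) (hs : 1 ≤ s) (hl : 1 ≤ ℓ) (hη : 1 ≤ η) :
    (Nat.card {E : Matrix (Fin s) (Fin ℓ × Fin η) K //
        srw Fq E = t ∧ E.rank = t} : ℤ)
    = (∏ j ∈ Finset.range t, ((q : ℤ) ^ (s * m) - (q : ℤ) ^ (j * m))) *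
      ∑ tt ∈ Finset.univ.filter
          (fun tt : Fin ℓ → Fin (min (s * m) η + 1) => ∑ i, (tt i : ℕ) = t),
        ∏ i, (Gq Fq η (tt i) : ℤ) := by
  classical
  have := Fintype.ofFinite (Submodule Fq (Fin η → Fq))
  have hcard : ((Nat.card {E : Matrix (Fin s) (Fin ℓ × Fin η) K //
      srw Fq E = t ∧ E.rank = t} : ℕ) : ℤ) =
      (∏ j ∈ Finset.range t, ((q : ℤ) ^ (s * m) - (q : ℤ) ^ (j * m))) *
        (Nat.card {W : Fin ℓ → Submodule Fq (Fin η → Fq) //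
          ∑ i, finrank Fq ((Fin η → Fq) ⧸ W i) = t} : ℤ) := by
    rw [Nat.card_eq_fintype_card, Fintype.card_subtype,
      Finset.card_eq_sum_card_fiberwise (f := fun E i => LinearMap.ker (blockMap Fq E i))
        (t := Finset.univ.filter fun W : Fin ℓ → Submodule Fq (Fin η → Fq) =>
          ∑ i, finrank Fq ((Fin η → Fq) ⧸ W i) = t), Nat.cast_sum,
      Nat.card_eq_fintype_card, Fintype.card_subtype, mul_comm, ← nsmul_eq_mul]
    · refine Finset.sum_eq_card_nsmul fun W hW => ?_
      have hW : ∑ i, finrank Fq ((Fin η → Fq) ⧸ W i) = t := by simpa using hW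
      have key := card_blockMap_ker_eq (s := s) (K := K) W hW
      rw [hK, Nat.card_eq_fintype_card, Fintype.card_subtype] at key
      simp only [Nat.cast_pow, ← pow_mul, mul_comm m] at key
      rw [← key, Finset.filter_filter]
      congr 2
      ext E
      simp only [Finset.mem_filter, Finset.mem_univ, true_and]
      constructor
      · rintro ⟨⟨-, h⟩, h'⟩
        exact ⟨h', h⟩
      · rintro ⟨rfl, h⟩
        exact ⟨⟨(srw_eq_sum_finrank_quotient_ker E).trans hW, h⟩, rfl⟩
    · intro E hE
      simp only [Finset.coe_filter, Finset.mem_univ, true_and, Set.mem_ofPred_eq] at hE ⊢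
      rw [← srw_eq_sum_finrank_quotient_ker, hE.1]
  rw [hcard]
  rcases le_or_gt t s with hts | hts
  · rw [card_sum_finrank_quotient_eq Fq
      (min_le_min_right η (hts.trans (Nat.le_mul_of_pos_right s hm)))]
    push_cast
    rfl
  · rw [Finset.prod_eq_zero (Finset.mem_range.2 hts) (sub_self _), zero_mul, zero_mul]
end

section
/- Suppose the length partition has constant block lengths n_i = η for all i, so n = ℓη, and set μ := min(sm, η). Then for every t ≥ 0: #{E ∈ F_{q^m}^{s×n} : srw(E) = t} ≤ q^{smt} · Σ_{(t_1,...,t_ℓ)} ∏_{i=1}^ℓ G_q(η, t_i), where the sum ranges over all tuples (t_1,...,t_ℓ) of integers with 0 ≤ t_i ≤ μ and t_1+...+t_ℓ = t. -/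
open Matrix Finset

/-- There are at most `G_q(η, r) · q^{rN}` matrices of rank `r` in `F_q^{N×η}`: such a matrix is
determined by its row space together with its rows as elements of that space. -/
theorem card_rank_eq_le (Fq : Type) [Field Fq] [Finite Fq] (N η r : ℕ) :
    Nat.card {A : Matrix (Fin N) (Fin η) Fq // A.rank = r} ≤
      Gq Fq η r * Nat.card Fq ^ (r * N) := by
  classical
  have hcard : Nat.card (Σ W : {W : Submodule Fq (Fin η → Fq) // Module.finrank Fq W = r},
      (Fin N → W.1)) = Gq Fq η r * Nat.card Fq ^ (r * N) := by
    have := Fintype.ofFinite {W : Submodule Fq (Fin η → Fq) // Module.finrank Fq W = r}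
    rw [Nat.card_sigma, Finset.sum_congr rfl (g := fun _ => Nat.card Fq ^ (r * N))]
    · simp [Gq, Nat.card_eq_fintype_card]
    · intro W _
      rw [Nat.card_fun, Module.natCard_eq_pow_finrank (K := Fq), W.2, Nat.card_fin, pow_mul]
  rw [← hcard]
  refine Nat.card_le_card_of_injective
    (fun A => ⟨⟨Submodule.span Fq (Set.range A.1.row), by
      rw [← Matrix.rank_eq_finrank_span_row, A.2]⟩,
      fun i => ⟨A.1.row i, Submodule.subset_span ⟨i, rfl⟩⟩⟩) ?_
  intro A B h
  apply Subtype.ext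
  funext i j
  exact congrArg (fun x => (x.2 i : Fin η → Fq) j) h

/-- The dimension of the span of a family is the rank of its matrix of coordinates. -/
theorem rank_toMatrix_eq_finrank_span {F V : Type*} [Field F] [AddCommGroup V] [Module F V]
    {N η : ℕ} (b : Module.Basis (Fin N) F V) (v : Fin η → V) :
    (b.toMatrix v).rank = Module.finrank F (Submodule.span F (Set.range v)) := by
  rw [Matrix.rank_eq_finrank_span_cols, ← LinearEquiv.finrank_map_eq b.equivFun,
    Submodule.map_span, ← Set.range_comp]
  rfl

/-- The number of `η`-tuples spanning an `r`-dimensional subspace of an `N`-dimensional space. -/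
theorem card_finrank_span_eq_le (Fq : Type) [Field Fq] [Finite Fq] {V : Type*} [AddCommGroup V]
    [Module Fq V] [Module.Finite Fq V] (η r : ℕ) :
    Nat.card {v : Fin η → V // Module.finrank Fq (Submodule.span Fq (Set.range v)) = r} ≤
      Gq Fq η r * Nat.card Fq ^ (r * Module.finrank Fq V) := by
  let b := Module.finBasis Fq V
  refine le_trans (Nat.card_le_card_of_injective (fun v => ⟨b.toMatrix v.1, by
    rw [rank_toMatrix_eq_finrank_span, v.2]⟩) ?_) (card_rank_eq_le Fq _ η r)
  intro v w h
  apply Subtype.ext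
  funext j
  apply b.repr.injective
  ext i
  exact congrFun (congrFun (congrArg Subtype.val h) i) j

/-- Tuples whose weights sum to `t`, counted by their tuple of weights. -/
theorem card_sum_weight_eq {X : Type*} [Fintype X] {μ ℓ : ℕ} (ρ : X → ℕ) (hρ : ∀ x, ρ x ≤ μ)
    (t : ℕ) :
    Nat.card {f : Fin ℓ → X // ∑ i, ρ (f i) = t} =
      ∑ tt ∈ Finset.univ.filter (fun tt : Fin ℓ → Fin (μ + 1) => ∑ i, (tt i : ℕ) = t),
        ∏ i, Nat.card {x : X // ρ x = tt i} := by
  classical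
  rw [Nat.card_eq_fintype_card, Fintype.card_subtype,
    Finset.card_eq_sum_card_fiberwise
      (f := fun (f : Fin ℓ → X) i => (⟨ρ (f i), Nat.lt_succ_of_le (hρ _)⟩ : Fin (μ + 1)))
      (t := Finset.univ.filter (fun tt : Fin ℓ → Fin (μ + 1) => ∑ i, (tt i : ℕ) = t))]
  · refine Finset.sum_congr rfl fun tt htt => ?_
    simp only [Nat.card_eq_fintype_card, Fintype.card_subtype]
    rw [← Fintype.card_piFinset]
    congr 1
    ext f
    simp only [Finset.mem_filter, Finset.mem_univ, true_and, Fintype.mem_piFinset,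
      funext_iff, Fin.ext_iff] at htt ⊢
    refine ⟨fun h => h.2, fun h => ⟨?_, h⟩⟩
    rw [← htt]
    exact Finset.sum_congr rfl fun i _ => h i
  · intro f hf
    simpa using hf

/-- For constant block lengths `η` and `μ = min(sm, η)`, the number of
matrices of sum-rank weight `t` is at most `q^{smt} · Σ_{(t₁,…,t_ℓ)} ∏ᵢ G_q(η,tᵢ)`, the
sum ranging over all tuples with `0 ≤ tᵢ ≤ μ` and `Σ tᵢ = t`. -/
theorem stmt10 (q m s ℓ η t : ℕ) (Fq K : Type) [Field Fq] [Fintype Fq] [Field K] [Fintype K]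
    [Algebra Fq K]
    (hq : Fintype.card Fq = q) (hK : Fintype.card K = q ^ m)
    (hm : 1 ≤ m) (hs : 1 ≤ s) (hl : 1 ≤ ℓ) (hη : 1 ≤ η) :
    Nat.card {E : Matrix (Fin s) (Fin ℓ × Fin η) K // srw Fq E = t}
    ≤ q ^ (s * m * t) *
      ∑ tt ∈ Finset.univ.filter
          (fun tt : Fin ℓ → Fin (min (s * m) η + 1) => ∑ i, (tt i : ℕ) = t),
        ∏ i, Gq Fq η (tt i) := by
  have hm' : Module.finrank Fq K = m := by
    have h := Module.card_eq_pow_finrank (K := Fq) (V := K)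
    rw [hK, ← hq] at h
    exact (Nat.pow_right_injective (Fintype.one_lt_card (α := Fq)) h).symm
  have hN : Module.finrank Fq (Fin s → K) = s * m := by
    simp [Module.finrank_pi_fintype, hm']
  have hρ (v : Fin η → Fin s → K) :
      Module.finrank Fq (Submodule.span Fq (Set.range v)) ≤ min (s * m) η :=
    le_min (hN ▸ Submodule.finrank_le _) ((finrank_range_le_card (R := Fq) v).trans_eq (Fintype.card_fin η))
  let e : Matrix (Fin s) (Fin ℓ × Fin η) K ≃ (Fin ℓ → Fin η → Fin s → K) :=
    { toFun := fun E i j r => E r (i, j)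
      invFun := fun f r p => f p.1 p.2 r
      left_inv := fun _ => rfl
      right_inv := fun _ => rfl }
  have hcount : Nat.card {E : Matrix (Fin s) (Fin ℓ × Fin η) K // srw Fq E = t} =
      Nat.card {f : Fin ℓ → Fin η → Fin s → K //
        ∑ i, Module.finrank Fq (Submodule.span Fq (Set.range (f i))) = t} :=
    Nat.card_congr (e.subtypeEquiv fun _ => Iff.rfl)
  rw [hcount, card_sum_weight_eq
    (fun v : Fin η → Fin s → K => Module.finrank Fq (Submodule.span Fq (Set.range v))) hρ,
    Finset.mul_sum]
  refine Finset.sum_le_sum fun tt htt => ?_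
  have htt' : ∑ i, (tt i : ℕ) = t := (Finset.mem_filter.mp htt).2
  calc _ ≤ ∏ i, Gq Fq η (tt i) * q ^ ((tt i : ℕ) * (s * m)) := by
        refine Finset.prod_le_prod' fun i _ => ?_
        have h := card_finrank_span_eq_le Fq (V := Fin s → K) η (tt i)
        rwa [hN, Nat.card_eq_fintype_card (α := Fq), hq] at h
    _ = q ^ (s * m * t) * ∏ i, Gq Fq η (tt i) := by
        rw [Finset.prod_mul_distrib, Finset.prod_pow_eq_pow_sum, ← Finset.sum_mul, htt',
          mul_comm, mul_comm t]
end

section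
/- Let a, n, t be integers with t+1 ≤ n, and let M ∈ F_{q^m}^{n×(t+1)} be a fixed matrix with rank_{q^m}(M) = t+1; write M = [M' | c], where M' consists of the first t columns of M and c is the last column. Then the number of matrices H ∈ F_{q^m}^{a×n} such that rank_{q^m}(H·M') = t and rank_{q^m}(H·M) ≤ t equals (∏_{j=0}^{t−1}(q^{ma} − q^{mj})) · q^{mt} · q^{ma(n−t−1)}. -/
open Matrix Finset

/-- The fibres of a surjective additive homomorphism all have the size of its kernel. -/
theorem AddMonoidHom.natCard_preimage_of_surjective {G H : Type*} [AddCommGroup G]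
    [AddCommGroup H] (f : G →+ H) (hf : Function.Surjective f) (p : H → Prop) :
    Nat.card {x // p (f x)} = Nat.card {y // p y} * Nat.card f.ker := by
  obtain ⟨g, hg⟩ := hf.hasRightInverse
  rw [← Nat.card_prod]
  refine Nat.card_congr
    { toFun := fun x => (⟨f x.1, x.2⟩, ⟨x.1 - g (f x.1), by simp [hg (f x.1)]⟩)
      invFun := fun y => ⟨g y.1.1 + y.2.1, by
        have h : f y.2.1 = 0 := y.2.2
        simpa [h, hg y.1.1] using y.1.2⟩
      left_inv := fun x => by simp
      right_inv := ?_ }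
  rintro ⟨⟨y, hy⟩, ⟨k, hk⟩⟩
  have h : f k = 0 := hk
  simp [h, hg y]

/-- Along a surjective additive homomorphism, a set and its preimage have the same density. -/
theorem AddMonoidHom.natCard_preimage_mul_natCard {G H : Type*} [AddCommGroup G]
    [AddCommGroup H] (f : G →+ H) (hf : Function.Surjective f) (p : H → Prop) :
    Nat.card {x // p (f x)} * Nat.card H = Nat.card {y // p y} * Nat.card G := by
  have h := f.natCard_preimage_of_surjective hf fun _ => True
  simp only [Nat.card_congr (Equiv.subtypeUnivEquiv fun _ => trivial)] at h
  rw [f.natCard_preimage_of_surjective hf p, h]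
  ring

namespace Matrix

variable {K : Type*} [Field K]

theorem rank_eq_card_iff_linearIndependent_col {m n : Type*} [Finite m] [Fintype n]
    (A : Matrix m n K) :
    A.rank = Fintype.card n ↔ LinearIndependent K A.col := by
  rw [linearIndependent_iff_card_eq_finrank_span, rank_eq_finrank_span_cols, Set.finrank, eq_comm]

theorem exists_left_inverse_of_rank_eq_card {m n : Type*} [Fintype m] [DecidableEq n] [Fintype n]
    (A : Matrix m n K) (hA : A.rank = Fintype.card n) : ∃ B : Matrix n m K, B * A = 1 := by
  rw [← vecMul_surjective_iff_exists_left_inverse]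
  have h : LinearMap.range Aᵀ.mulVecLin = ⊤ :=
    Submodule.eq_top_of_finrank_eq (by
      rw [Module.finrank_fintype_fun_eq_card, ← hA, ← rank_transpose]; rfl)
  intro v
  obtain ⟨w, hw⟩ := LinearMap.range_eq_top.mp h v
  exact ⟨w, by simpa [mulVec_transpose] using hw⟩

/-- A matrix whose first `t` columns have full rank `t`, and which itself has rank at most `t`, is
a linearly independent family together with a vector in its span. -/
theorem rank_init_eq_and_rank_le_iff {m : Type*} [Finite m] {t : ℕ}
    (N : Matrix m (Fin (t + 1)) K) :
    (N.submatrix id Fin.castSucc).rank = t ∧ N.rank ≤ t ↔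
      LinearIndependent K (Fin.init N.col : Fin t → m → K) ∧
        N.col (Fin.last t) ∈ Submodule.span K (Set.range (Fin.init N.col : Fin t → m → K)) := by
  have h₁ := rank_eq_card_iff_linearIndependent_col (N.submatrix id Fin.castSucc)
  have h₂ := rank_eq_card_iff_linearIndependent_col N
  have h₃ := N.rank_le_card_width
  rw [Fintype.card_fin] at h₁ h₂ h₃
  rw [← Fin.snoc_init_self N.col, linearIndependent_finSnoc] at h₂
  change _ ↔ LinearIndependent K (Fin.init N.col : Fin t → m → K) at h₁
  rw [h₁]
  refine and_congr_right fun h => ?_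
  rw [← not_iff_not, ← and_iff_right (a := LinearIndependent K _) (b := ¬ _ ∈ _) h, ← h₂]
  omega

theorem natCard_rank_init_eq_and_rank_le [Fintype K] (a t : ℕ) :
    Nat.card {N : Matrix (Fin a) (Fin (t + 1)) K //
        (N.submatrix id Fin.castSucc).rank = t ∧ N.rank ≤ t} =
      (∏ j ∈ Finset.range t, (Fintype.card K ^ a - Fintype.card K ^ j)) * Fintype.card K ^ t := by
  have hext {x y : Σ s : {s : Fin t → Fin a → K // LinearIndependent K s},
      Submodule.span K (Set.range s.1)} (h₁ : x.1.1 = y.1.1) (h₂ : x.2.1 = y.2.1) : x = y := by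
    obtain ⟨⟨s, _⟩, ⟨v, _⟩⟩ := x
    obtain ⟨⟨s', _⟩, ⟨v', _⟩⟩ := y
    obtain rfl : s = s' := h₁
    obtain rfl : v = v' := h₂
    rfl
  let e : {N : Matrix (Fin a) (Fin (t + 1)) K //
        (N.submatrix id Fin.castSucc).rank = t ∧ N.rank ≤ t} ≃
      (Σ s : {s : Fin t → Fin a → K // LinearIndependent K s},
        Submodule.span K (Set.range s.1)) :=
    { toFun := fun N =>
        ⟨⟨Fin.init N.1.col, ((rank_init_eq_and_rank_le_iff N.1).1 N.2).1⟩,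
          ⟨N.1.col (Fin.last t), ((rank_init_eq_and_rank_le_iff N.1).1 N.2).2⟩⟩
      invFun := fun x => ⟨(of (Fin.snoc x.1.1 x.2.1 : Fin (t + 1) → Fin a → K))ᵀ, by
        rw [rank_init_eq_and_rank_le_iff]
        change LinearIndependent K
          (Fin.init (Fin.snoc x.1.1 x.2.1 : Fin (t + 1) → Fin a → K) : Fin t → Fin a → K) ∧
          (Fin.snoc x.1.1 x.2.1 : Fin (t + 1) → Fin a → K) (Fin.last t) ∈ Submodule.span K
          (Set.range (Fin.init (Fin.snoc x.1.1 x.2.1 : Fin (t + 1) → Fin a → K) :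
            Fin t → Fin a → K))
        rw [Fin.init_snoc, Fin.snoc_last]
        exact ⟨x.1.2, x.2.2⟩⟩
      left_inv := fun N => Subtype.ext <| by
        change (of (Fin.snoc (Fin.init N.1.col) (N.1.col (Fin.last t)) :
          Fin (t + 1) → Fin a → K))ᵀ = N.1
        rw [Fin.snoc_init_self]
        rfl
      right_inv := by
        rintro ⟨⟨s, hs⟩, ⟨v, hv⟩⟩
        have h₁ : Fin.init (of (Fin.snoc s v : Fin (t + 1) → Fin a → K))ᵀ.col = s :=
          Fin.init_snoc (α := fun _ => Fin a → K) v s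
        have h₂ : (of (Fin.snoc s v : Fin (t + 1) → Fin a → K))ᵀ.col (Fin.last t) = v :=
          Fin.snoc_last (α := fun _ => Fin a → K) v s
        exact hext h₁ h₂ }
  have hspan (s : {s : Fin t → Fin a → K // LinearIndependent K s}) :
      Nat.card (Submodule.span K (Set.range s.1)) = Fintype.card K ^ t := by
    rw [Module.natCard_eq_pow_finrank (K := K), finrank_span_eq_card s.2, Fintype.card_fin,
      Nat.card_eq_fintype_card]
  have := Fintype.ofFinite {s : Fin t → Fin a → K // LinearIndependent K s}
  rw [Nat.card_congr e, Nat.card_sigma]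
  simp only [hspan, Finset.sum_const, Finset.card_univ, smul_eq_mul]
  congr 1
  rw [← Nat.card_eq_fintype_card]
  by_cases hta : t ≤ a
  · rw [card_linearIndependent (by simpa using hta), Module.finrank_fin_fun,
      Finset.prod_range fun j => Fintype.card K ^ a - Fintype.card K ^ j]
  · have : IsEmpty {s : Fin t → Fin a → K // LinearIndependent K s} :=
      ⟨fun s => hta (by simpa using s.2.fintype_card_le_finrank)⟩
    exact Nat.card_of_isEmpty.trans
      (Finset.prod_eq_zero (Finset.mem_range.2 (not_le.1 hta)) (Nat.sub_self (Fintype.card K ^ a))).symm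

end Matrix


open Matrix Finset

/-- Let `t + 1 ≤ n` and let `M = [M' | c] ∈ F_{q^m}^{n×(t+1)}` have full
rank `t+1`, where `M'` consists of the first `t` columns. The number of matrices
`H ∈ F_{q^m}^{a×n}` with `rank(H·M') = t` and `rank(H·M) ≤ t` equals
`(∏_{j<t}(q^{ma} − q^{mj})) · q^{mt} · q^{ma(n−t−1)}`. -/
theorem stmt14 (q m a n t : ℕ) (K : Type) [Field K] [Fintype K]
    (hK : Fintype.card K = q ^ m) (hm : 1 ≤ m) (ha : 1 ≤ a)
    (htn : t + 1 ≤ n)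
    (M : Matrix (Fin n) (Fin (t + 1)) K) (hM : M.rank = t + 1) :
    Nat.card {H : Matrix (Fin a) (Fin n) K //
        (H * M.submatrix id Fin.castSucc).rank = t ∧ (H * M).rank ≤ t}
    = (∏ j ∈ Finset.range t, (q ^ (m * a) - q ^ (m * j))) * q ^ (m * t) *
        q ^ (m * a * (n - t - 1)) := by
  obtain ⟨L, hL⟩ := M.exists_left_inverse_of_rank_eq_card (by simpa using hM)
  have hsurj : Function.Surjective (addMonoidHomMulRight M : Matrix (Fin a) (Fin n) K →+ _) :=
    fun N => ⟨N * L, by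
      change N * L * M = N
      rw [Matrix.mul_assoc, hL, Matrix.mul_one]⟩
  have h := AddMonoidHom.natCard_preimage_mul_natCard _ hsurj fun N =>
    (N.submatrix id Fin.castSucc).rank = t ∧ N.rank ≤ t
  have hcard (k : ℕ) : Nat.card (Matrix (Fin a) (Fin k) K) = q ^ (m * a * k) := by
    rw [Module.natCard_eq_pow_finrank (K := K), Module.finrank_matrix, Nat.card_eq_fintype_card,
      hK]
    simp [← pow_mul, mul_assoc]
  have hq : 0 < q ^ (m * a * (t + 1)) := by
    have := hK ▸ Fintype.card_pos (α := K)
    exact pow_pos (Nat.pos_of_ne_zero fun h0 => by simp [h0, show m ≠ 0 by omega] at this) _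
  rw [natCard_rank_init_eq_and_rank_le, hcard, hcard, hK] at h
  simp only [← pow_mul] at h
  refine Nat.eq_of_mul_eq_mul_right hq (Eq.trans h ?_)
  obtain ⟨d, rfl⟩ := Nat.exists_eq_add_of_le htn
  rw [show t + 1 + d - t - 1 = d by omega, mul_add (m * a) (t + 1) d, pow_add]
  ring
end
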